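/- For every integer d ≥ 4 there exist a full-dimensional integral polytope P ⊆ ℝ^d and a polynomial p of degree d with rational coefficients and constant coefficient 1 such that i(P,t) = p(t) for every positive integer t, the coefficients of t and t² in p are negative, and the coefficient of t^j in p is positive for every j with 3 ≤ j ≤ d−2. -/

import Mathlib

open scoped Pointwise BigOperators

/-- `P` is an integral polytope: the convex hull of finitely many points
with integer coordinates. -/
def IsIntegralPolytope {N : ℕ} (P : Set (Fin N → ℝ)) : Prop :=
  ∃ V : Finset (Fin N → ℝ),
    (∀ v ∈ V, ∀ i, ∃ z : ℤ, v i = (z : ℝ)) ∧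
    P = convexHull ℝ (V : Set (Fin N → ℝ))

/-- `latticeCount P t = i(P,t)`: the number of points of `ℤ^N` in the dilate `t • P`. -/
noncomputable def latticeCount {N : ℕ} (P : Set (Fin N → ℝ)) (t : ℕ) : ℕ :=
  Set.ncard {x : Fin N → ℝ | x ∈ (t : ℝ) • P ∧ ∀ i, ∃ z : ℤ, x i = (z : ℝ)}

/-- The tetrahedron with vertices `(0,0,0)`, `(r,0,0)`, `(0,r,0)`, `(r,r,mr)`: the `r`-th dilate
of a Reeve tetrahedron. -/
def reeve (r m : ℝ) : Set (ℝ × ℝ × ℝ) :=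
  {q | 0 ≤ q.2.2 ∧ m * (q.1 + q.2.1 - r) ≤ q.2.2 ∧ q.2.2 ≤ m * q.1 ∧ q.2.2 ≤ m * q.2.1}

/-- The product of a dilated Reeve tetrahedron and the unit cube `[0,1]^k`. -/
def reevePrism (k : ℕ) (r m : ℝ) : Set (Fin (k + 3) → ℝ) :=
  {x | (x 0, x 1, x 2) ∈ reeve r m ∧ ∀ i : Fin k, 0 ≤ x i.succ.succ.succ ∧ x i.succ.succ.succ ≤ 1}

theorem forall_fin_add_three {k : ℕ} {Q : Fin (k + 3) → Prop} :
    (∀ i, Q i) ↔ Q 0 ∧ Q 1 ∧ Q 2 ∧ ∀ i : Fin k, Q i.succ.succ.succ := by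
  rw [Fin.forall_fin_succ, Fin.forall_fin_succ, Fin.forall_fin_succ]
  rfl

/-- Prepending three coordinates to a vector, as a linear map. -/
def consThree (k : ℕ) : ((ℝ × ℝ × ℝ) × (Fin k → ℝ)) →ₗ[ℝ] (Fin (k + 3) → ℝ) where
  toFun p := Fin.cons p.1.1 (Fin.cons p.1.2.1 (Fin.cons p.1.2.2 p.2 : Fin (k + 1) → ℝ) :
    Fin (k + 2) → ℝ)
  map_add' p q := by
    rw [funext_iff, forall_fin_add_three]
    exact ⟨rfl, rfl, rfl, fun _ => rfl⟩
  map_smul' c p := by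
    rw [funext_iff, forall_fin_add_three]
    exact ⟨rfl, rfl, rfl, fun _ => rfl⟩

theorem consThree_zero {k : ℕ} (p : (ℝ × ℝ × ℝ) × (Fin k → ℝ)) : consThree k p 0 = p.1.1 := rfl

theorem consThree_one {k : ℕ} (p : (ℝ × ℝ × ℝ) × (Fin k → ℝ)) : consThree k p 1 = p.1.2.1 := rfl

theorem consThree_two {k : ℕ} (p : (ℝ × ℝ × ℝ) × (Fin k → ℝ)) : consThree k p 2 = p.1.2.2 := rfl

theorem consThree_succ {k : ℕ} (p : (ℝ × ℝ × ℝ) × (Fin k → ℝ)) (i : Fin k) :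
    consThree k p i.succ.succ.succ = p.2 i := rfl

theorem consThree_surj {k : ℕ} (x : Fin (k + 3) → ℝ) :
    consThree k ((x 0, x 1, x 2), fun i => x i.succ.succ.succ) = x := by
  rw [funext_iff, forall_fin_add_three]
  exact ⟨rfl, rfl, rfl, fun _ => rfl⟩

theorem convex_reeve (r m : ℝ) : Convex ℝ (reeve r m) := by
  rintro ⟨x, y, z⟩ ⟨h1, h2, h3, h4⟩ ⟨x', y', z'⟩ ⟨h1', h2', h3', h4'⟩ a b ha hb hab
  obtain rfl : b = 1 - a := by linarith
  simp only at h1 h2 h3 h4 h1' h2' h3' h4'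
  refine ⟨?_, ?_, ?_, ?_⟩ <;> simp only [Prod.smul_mk, Prod.mk_add_mk, smul_eq_mul]
  · positivity
  · nlinarith [mul_le_mul_of_nonneg_left h2 ha, mul_le_mul_of_nonneg_left h2' hb]
  · nlinarith [mul_le_mul_of_nonneg_left h3 ha, mul_le_mul_of_nonneg_left h3' hb]
  · nlinarith [mul_le_mul_of_nonneg_left h4 ha, mul_le_mul_of_nonneg_left h4' hb]

theorem reeve_eq_convexHull {r m : ℝ} (hr : 0 < r) (hm : 0 < m) :
    reeve r m = convexHull ℝ {(0, 0, 0), (r, 0, 0), (0, r, 0), (r, r, m * r)} := by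
  apply Set.Subset.antisymm
  · rintro ⟨x, y, z⟩ ⟨h1, h2, h3, h4⟩
    simp only at h1 h2 h3 h4
    set S : Set (ℝ × ℝ × ℝ) := {(0, 0, 0), (r, 0, 0), (0, r, 0), (r, r, m * r)}
    have hsub := subset_convexHull ℝ S
    let w : Fin 4 → ℝ := ![(z - m * (x + y - r)) / (m * r), (m * x - z) / (m * r),
      (m * y - z) / (m * r), z / (m * r)]
    let v : Fin 4 → ℝ × ℝ × ℝ := ![(0, 0, 0), (r, 0, 0), (0, r, 0), (r, r, m * r)]
    have hw : ∀ i ∈ Finset.univ, 0 ≤ w i := by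
      intro i _
      have : 0 < m * r := by positivity
      fin_cases i <;> simp only [w] <;> refine div_nonneg ?_ this.le <;> linarith
    have hv : ∀ i ∈ Finset.univ, v i ∈ convexHull ℝ S := by
      intro i _
      apply hsub
      fin_cases i <;> simp [v, S]
    have hsum : ∑ i, w i = 1 := by
      simp only [Fin.sum_univ_four, w]
      simp
      field_simp
      ring
    have := (convex_convexHull ℝ S).sum_mem hw hsum hv
    convert this using 1
    simp only [Fin.sum_univ_four, w, v]
    simp
    refine ⟨?_, ?_, ?_⟩ <;> field_simp <;> ring
  · refine convexHull_min ?_ (convex_reeve r m)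
    have : 0 < m * r := by positivity
    rintro q (rfl | rfl | rfl | rfl) <;> simp [reeve] <;> nlinarith

theorem reevePrism_eq_image (k : ℕ) (r m : ℝ) :
    reevePrism k r m = consThree k '' (reeve r m ×ˢ Set.univ.pi fun _ => Set.Icc (0 : ℝ) 1) := by
  apply Set.Subset.antisymm
  · rintro x ⟨h, h'⟩
    exact ⟨((x 0, x 1, x 2), fun i => x i.succ.succ.succ), ⟨h, fun i _ => h' i⟩, consThree_surj x⟩
  · rintro _ ⟨p, ⟨h, h'⟩, rfl⟩
    exact ⟨h, fun i => h' i trivial⟩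

theorem isIntegralPolytope_reevePrism (k : ℕ) {r m : ℕ} (hr : 0 < r) (hm : 0 < m) :
    IsIntegralPolytope (reevePrism k r m) := by
  classical
  set S : Set (ℝ × ℝ × ℝ) :=
    {(0, 0, 0), ((r : ℝ), 0, 0), (0, (r : ℝ), 0), ((r : ℝ), (r : ℝ), (m : ℝ) * r)} with hS
  set W : Set (Fin (k + 3) → ℝ) :=
    consThree k '' (S ×ˢ Set.univ.pi fun _ => ({0, 1} : Set ℝ)) with hW
  have hfin : W.Finite := by
    refine Set.Finite.image _ (Set.Finite.prod ?_ (Set.Finite.pi fun _ => ?_)) <;>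
      simp [S]
  refine ⟨hfin.toFinset, ?_, ?_⟩
  · intro v hv
    rw [Set.Finite.mem_toFinset] at hv
    obtain ⟨⟨q, u⟩, ⟨hq, hu⟩, rfl⟩ := hv
    rw [forall_fin_add_three]
    have hcube : ∀ i : Fin k, ∃ z : ℤ, u i = (z : ℝ) := by
      intro i
      rcases hu i trivial with h | h
      · exact ⟨0, by simpa using h⟩
      · exact ⟨1, by simpa using h⟩
    simp only [consThree_zero, consThree_one, consThree_two, consThree_succ]
    have h0 : ∃ z : ℤ, (0 : ℝ) = z := ⟨0, by simp⟩
    have h1 : ∃ z : ℤ, (r : ℝ) = z := ⟨r, by simp⟩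
    have h2 : ∃ z : ℤ, (m : ℝ) * r = z := ⟨m * r, by simp⟩
    rcases hq with h | h | h | h <;> simp only [Set.mem_singleton_iff] at h <;> subst h
    · exact ⟨h0, h0, h0, hcube⟩
    · exact ⟨h1, h0, h0, hcube⟩
    · exact ⟨h0, h1, h0, hcube⟩
    · exact ⟨h1, h1, h2, hcube⟩
  · rw [Set.Finite.coe_toFinset, reevePrism_eq_image, hW, ← LinearMap.image_convexHull,
      convexHull_prod, convexHull_pi, hS, reeve_eq_convexHull (by positivity) (by positivity)]
    simp only [convexHull_pair, segment_eq_Icc (zero_le_one (α := ℝ))]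

theorem affineSpan_reevePrism (k : ℕ) {r m : ℝ} (hr : 0 < r) (hm : 0 < m) :
    affineSpan ℝ (reevePrism k r m) = ⊤ := by
  set U : Set (Fin (k + 3) → ℝ) := {x | 0 < x 2} ∩ {x | m * (x 0 + x 1 - r) < x 2} ∩
    {x | x 2 < m * x 0} ∩ {x | x 2 < m * x 1} ∩
    ⋂ i : Fin k, ({x | 0 < x i.succ.succ.succ} ∩ {x | x i.succ.succ.succ < 1}) with hU
  have hopen : IsOpen U := by
    refine ((((isOpen_lt ?_ ?_).inter (isOpen_lt ?_ ?_)).inter (isOpen_lt ?_ ?_)).inter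
      (isOpen_lt ?_ ?_)).inter (isOpen_iInter_of_finite fun i => (isOpen_lt ?_ ?_).inter
      (isOpen_lt ?_ ?_)) <;> fun_prop
  have hne : U.Nonempty := by
    refine ⟨consThree k ((r / 2, r / 2, m * r / 4), fun _ => 1 / 2), ?_⟩
    have : 0 < m * r := by positivity
    simp only [hU, Set.mem_inter_iff, Set.mem_ofPred_eq, Set.mem_iInter, consThree_zero,
      consThree_one, consThree_two, consThree_succ]
    refine ⟨⟨⟨⟨?_, ?_⟩, ?_⟩, ?_⟩, fun _ => ⟨?_, ?_⟩⟩ <;> nlinarith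
  have hsub : U ⊆ reevePrism k r m := by
    rintro x ⟨⟨⟨⟨h1, h2⟩, h3⟩, h4⟩, h5⟩
    rw [Set.mem_iInter] at h5
    exact ⟨⟨le_of_lt h1, le_of_lt h2, le_of_lt h3, le_of_lt h4⟩,
      fun i => ⟨le_of_lt (h5 i).1, le_of_lt (h5 i).2⟩⟩
  exact top_le_iff.1 ((hopen.affineSpan_eq_top hne).symm.le.trans (affineSpan_mono ℝ hsub))

theorem mem_smul_reevePrism {k : ℕ} {r m t : ℝ} (ht : 0 < t) (x : Fin (k + 3) → ℝ) :
    x ∈ t • reevePrism k r m ↔ (x 0, x 1, x 2) ∈ reeve (r * t) m ∧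
      ∀ i : Fin k, 0 ≤ x i.succ.succ.succ ∧ x i.succ.succ.succ ≤ t := by
  rw [Set.mem_smul_set_iff_inv_smul_mem₀ ht.ne']
  simp only [reevePrism, reeve, Set.mem_ofPred_eq, Pi.smul_apply, smul_eq_mul]
  have key : ∀ a b : ℝ, t⁻¹ * a ≤ b ↔ a ≤ t * b := fun a b => inv_mul_le_iff₀ ht
  have key' : ∀ a b : ℝ, b ≤ t⁻¹ * a ↔ t * b ≤ a := fun a b => le_inv_mul_iff₀ ht
  simp only [key, key', mul_zero, mul_one]
  have e1 : t * (m * (t⁻¹ * x 0 + t⁻¹ * x 1 - r)) = m * (x 0 + x 1 - r * t) := by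
    field_simp
  have e2 : ∀ a, t * (m * (t⁻¹ * a)) = m * a := fun a => by field_simp
  rw [e1, e2, e2]

theorem two_mul_sum_min (a c : ℕ) :
    2 * ∑ b ∈ Finset.range (a + c + 1), min a b = a * (a + 1) + 2 * a * c := by
  induction c with
  | zero =>
    have : ∑ b ∈ Finset.range (a + 1), min a b = ∑ b ∈ Finset.range (a + 1), b :=
      Finset.sum_congr rfl fun b hb => min_eq_right (by simp at hb; omega)
    have h := Finset.sum_range_id_mul_two (a + 1)
    simp only [add_zero, this]
    simp only [Nat.add_sub_cancel] at h
    linarith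
  | succ c ih =>
    rw [← add_assoc, Finset.sum_range_succ, mul_add, ih, min_eq_left (by omega)]
    ring

theorem two_mul_sum_tsub (a c : ℕ) :
    2 * ∑ b ∈ Finset.range (a + c + 1), (b - c) = a * (a + 1) := by
  induction a with
  | zero =>
    simp
    intro i hi
    omega
  | succ a ih =>
    rw [show a + 1 + c + 1 = (a + c + 1) + 1 by ring, Finset.sum_range_succ, mul_add, ih,
      show a + c + 1 - c = a + 1 by omega]
    ring

theorem sum_reeve_height {a n : ℕ} (h : a ≤ n) :
    ∑ b ∈ Finset.range (n + 1), ((min a b : ℕ) - ((a + b - n : ℕ) : ℚ)) = a * (n - a) := by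
  obtain ⟨c, rfl⟩ := Nat.exists_eq_add_of_le h
  have h1 : (2 : ℚ) * ∑ b ∈ Finset.range (a + c + 1), ((min a b : ℕ) : ℚ) =
      a * (a + 1) + 2 * a * c := by exact_mod_cast two_mul_sum_min a c
  have h2 : (2 : ℚ) * ∑ b ∈ Finset.range (a + c + 1), ((b - c : ℕ) : ℚ) = a * (a + 1) := by
    exact_mod_cast two_mul_sum_tsub a c
  simp only [Finset.sum_sub_distrib, Nat.add_sub_add_left]
  push_cast at h1 h2 ⊢
  linarith

theorem sum_mul_sub (n : ℕ) (s : ℚ) :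
    ∑ a ∈ Finset.range (n + 1), (a : ℚ) * (s - a) =
      s * (n * (n + 1) / 2) - n * (n + 1) * (2 * n + 1) / 6 := by
  induction n with
  | zero => simp
  | succ n ih =>
    rw [Finset.sum_range_succ, ih]
    push_cast
    ring

/-- The lattice points of the dilate of size `n` of the Reeve tetrahedron of height `m`. -/
def reevePoints (n m : ℕ) : Finset (Σ _ : ℕ × ℕ, ℕ) :=
  (Finset.range (n + 1) ×ˢ Finset.range (n + 1)).sigma fun q =>
    Finset.Icc (m * (q.1 + q.2 - n)) (m * min q.1 q.2)

theorem card_reevePoints (n m : ℕ) :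
    ((reevePoints n m).card : ℚ) = (n + 1) ^ 2 + m * (n ^ 3 - n) / 6 := by
  have hcard : ∀ a ∈ Finset.range (n + 1), ∀ b ∈ Finset.range (n + 1),
      ((Finset.Icc (m * (a + b - n)) (m * min a b)).card : ℚ) =
        1 + m * ((min a b : ℕ) - ((a + b - n : ℕ) : ℚ)) := by
    intro a ha b hb
    simp only [Finset.mem_range] at ha hb
    have : m * (a + b - n) ≤ m * min a b := Nat.mul_le_mul_left _ (by omega)
    rw [Nat.card_Icc, Nat.cast_sub (by omega)]
    push_cast
    ring
  rw [reevePoints, Finset.card_sigma, Nat.cast_sum, Finset.sum_product]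
  calc _ = ∑ a ∈ Finset.range (n + 1), ((n + 1 : ℚ) + m * (a * (n - a))) := by
        refine Finset.sum_congr rfl fun a ha => ?_
        rw [Finset.sum_congr rfl (hcard a ha), Finset.sum_add_distrib, ← Finset.mul_sum,
          sum_reeve_height (by simp at ha; omega)]
        simp
    _ = _ := by
        rw [Finset.sum_add_distrib, ← Finset.mul_sum, sum_mul_sub]
        simp
        ring

theorem latticeCount_reevePrism (k : ℕ) {r m t : ℕ} (hm : 0 < m) (ht : 0 < t) :
    latticeCount (reevePrism k r m) t = (reevePoints (r * t) m).card * (t + 1) ^ k := by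
  classical
  let F : (Σ _ : ℕ × ℕ, ℕ) × (Fin k → ℕ) → Fin (k + 3) → ℝ := fun p =>
    consThree k (((p.1.1.1 : ℝ), (p.1.1.2 : ℝ), (p.1.2 : ℝ)), fun i => (p.2 i : ℝ))
  have hF : Function.Injective F := by
    rintro ⟨⟨⟨a, b⟩, c⟩, u⟩ ⟨⟨⟨a', b'⟩, c'⟩, u'⟩ h
    have h0 : (a : ℝ) = a' := congrFun h 0
    have h1 : (b : ℝ) = b' := congrFun h 1
    have h2 : (c : ℝ) = c' := congrFun h 2
    have h3 : u = u' := funext fun i => Nat.cast_injective (R := ℝ) (congrFun h i.succ.succ.succ)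
    norm_cast at h0 h1 h2
    subst h0 h1 h2 h3
    rfl
  let A : Finset ((Σ _ : ℕ × ℕ, ℕ) × (Fin k → ℕ)) :=
    reevePoints (r * t) m ×ˢ Fintype.piFinset fun _ => Finset.range (t + 1)
  have hA : {x : Fin (k + 3) → ℝ | x ∈ (t : ℝ) • reevePrism k r m ∧ ∀ i, ∃ z : ℤ, x i = (z : ℝ)} =
      ((A.image F : Finset _) : Set (Fin (k + 3) → ℝ)) := by
    have hm' : (0 : ℝ) < m := by positivity
    ext x
    simp only [Set.mem_ofPred_eq, mem_smul_reevePrism (show (0 : ℝ) < t by positivity),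
      Finset.coe_image, Set.mem_image, Finset.mem_coe]
    constructor
    · rintro ⟨⟨⟨h1, h2, h3, h4⟩, h5⟩, hz⟩
      simp only at h1 h2 h3 h4
      have nat_of : ∀ i, 0 ≤ x i → ∃ n : ℕ, x i = n := by
        intro i hi
        obtain ⟨z, hz⟩ := hz i
        rw [hz] at hi
        lift z to ℕ using by exact_mod_cast hi
        exact ⟨z, by simpa using hz⟩
      obtain ⟨a, ha⟩ := nat_of 0 (nonneg_of_mul_nonneg_right (h1.trans h3) hm')
      obtain ⟨b, hb⟩ := nat_of 1 (nonneg_of_mul_nonneg_right (h1.trans h4) hm')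
      obtain ⟨c, hc⟩ := nat_of 2 h1
      choose u hu using fun i : Fin k => nat_of i.succ.succ.succ (h5 i).1
      refine ⟨⟨⟨(a, b), c⟩, u⟩, ?_, ?_⟩
      · rw [ha, hb, hc] at h2
        rw [ha, hc] at h3
        rw [hb, hc] at h4
        have e1 := le_of_mul_le_mul_left (h2.trans h3) hm'
        have e2 := le_of_mul_le_mul_left (h2.trans h4) hm'
        have ha' : a ≤ r * t := by
          have : (a : ℝ) ≤ r * t := by linarith
          exact_mod_cast this
        have hb' : b ≤ r * t := by
          have : (b : ℝ) ≤ r * t := by linarith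
          exact_mod_cast this
        have hu' : ∀ i, u i ≤ t := fun i => by
          have := (h5 i).2
          rw [hu] at this
          exact_mod_cast this
        have h3' : c ≤ m * a := by exact_mod_cast h3
        have h4' : c ≤ m * b := by exact_mod_cast h4
        have h2' : m * (a + b - r * t) ≤ c := by
          rcases le_total (a + b) (r * t) with h | h
          · simp [Nat.sub_eq_zero_of_le h]
          · have : ((m * (a + b - r * t : ℕ) : ℕ) : ℝ) ≤ c := by
              push_cast [Nat.cast_sub h]
              exact h2
            exact_mod_cast this
        simp only [A, reevePoints, Finset.mem_product, Finset.mem_sigma, Finset.mem_range,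
          Finset.mem_Icc, Fintype.mem_piFinset, Nat.lt_succ_iff]
        refine ⟨⟨⟨ha', hb'⟩, h2', ?_⟩, hu'⟩
        rcases min_choice a b with h | h <;> rw [h] <;> assumption
      · rw [← consThree_surj x]
        simp only [F, ha, hb, hc, hu]
    · rintro ⟨⟨⟨⟨a, b⟩, c⟩, u⟩, hp, rfl⟩
      simp only [A, reevePoints, Finset.mem_product, Finset.mem_sigma, Finset.mem_range,
        Finset.mem_Icc, Fintype.mem_piFinset, Nat.lt_succ_iff] at hp
      obtain ⟨⟨⟨ha, hb⟩, h1, h2⟩, hu⟩ := hp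
      simp only [F, consThree_zero, consThree_one, consThree_two, consThree_succ]
      refine ⟨⟨⟨by positivity, ?_, ?_, ?_⟩, fun i => ⟨by positivity, by exact_mod_cast hu i⟩⟩, ?_⟩
      · have h : ((a : ℝ) + b - r * t) ≤ ((a + b - r * t : ℕ) : ℝ) := by
          rw [sub_le_iff_le_add]
          exact_mod_cast (by omega : a + b ≤ (a + b - r * t) + r * t)
        have h1' : (m : ℝ) * ((a + b - r * t : ℕ) : ℝ) ≤ c := by exact_mod_cast h1
        exact (mul_le_mul_of_nonneg_left h hm'.le).trans h1'
      · have h := h2.trans (Nat.mul_le_mul_left m (min_le_left a b))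
        simp only
        exact_mod_cast h
      · have h := h2.trans (Nat.mul_le_mul_left m (min_le_right a b))
        simp only
        exact_mod_cast h
      · rw [forall_fin_add_three]
        exact ⟨⟨a, by simp [consThree_zero]⟩, ⟨b, by simp [consThree_one]⟩,
          ⟨c, by simp [consThree_two]⟩, fun i => ⟨u i, by simp [consThree_succ]⟩⟩
  rw [latticeCount, hA, Set.ncard_coe_finset, Finset.card_image_of_injective _ hF]
  simp [A]

open Polynomial in
/-- The Ehrhart polynomial of `reevePrism k r (6 * M)`. -/
noncomputable def reevePrismPoly (k : ℕ) (r M : ℚ) : ℚ[X] :=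
  (C (M * r ^ 3) * X ^ 3 + C (r ^ 2) * X ^ 2 + C (2 * r - M * r) * X ^ 1 + 1) * (1 + X) ^ k

theorem eval_reevePrismPoly (k : ℕ) (r M t : ℚ) :
    (reevePrismPoly k r M).eval t =
      ((r * t + 1) ^ 2 + 6 * M * ((r * t) ^ 3 - r * t) / 6) * (t + 1) ^ k := by
  simp [reevePrismPoly]
  ring

open Polynomial in
theorem natDegree_reevePrismPoly (k : ℕ) {r M : ℚ} (hr : r ≠ 0) (hM : M ≠ 0) :
    (reevePrismPoly k r M).natDegree = k + 3 := by
  have h1 : (C (M * r ^ 3) * X ^ 3 + C (r ^ 2) * X ^ 2 + C (2 * r - M * r) * X ^ 1 + 1 :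
      ℚ[X]).natDegree = 3 := by
    compute_degree!
  have h2 : ((1 + X : ℚ[X]) ^ k).natDegree = k := by
    rw [natDegree_pow, show (1 + X : ℚ[X]) = X + C 1 by simp [add_comm], natDegree_X_add_C, mul_one]
  have h3 : (1 + X : ℚ[X]) ^ k ≠ 0 :=
    pow_ne_zero _ (by rw [show (1 + X : ℚ[X]) = X + C 1 by simp [add_comm]]; exact X_add_C_ne_zero 1)
  rw [reevePrismPoly, natDegree_mul (fun h => by rw [h] at h1; simp at h1) h3, h1, h2, add_comm]

open Polynomial in
theorem coeff_reevePrismPoly (k : ℕ) (r M : ℚ) (j : ℕ) :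
    (reevePrismPoly k r M).coeff j =
      M * r ^ 3 * (if 3 ≤ j then (k.choose (j - 3) : ℚ) else 0) +
      r ^ 2 * (if 2 ≤ j then (k.choose (j - 2) : ℚ) else 0) +
      (2 * r - M * r) * (if 1 ≤ j then (k.choose (j - 1) : ℚ) else 0) + k.choose j := by
  simp only [reevePrismPoly, add_mul, mul_assoc (C _), coeff_add, coeff_C_mul, coeff_X_pow_mul',
    coeff_one_add_X_pow, one_mul]

theorem two_negative_rest_positive (d : ℕ) (hd : 4 ≤ d) :
    ∃ (P : Set (Fin d → ℝ)) (p : Polynomial ℚ),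
      IsIntegralPolytope P ∧ affineSpan ℝ P = ⊤ ∧
      p.natDegree = d ∧ p.coeff 0 = 1 ∧
      (∀ t : ℕ, 0 < t → (latticeCount P t : ℚ) = p.eval (t : ℚ)) ∧
      p.coeff 1 < 0 ∧ p.coeff 2 < 0 ∧
      (∀ j : ℕ, 3 ≤ j → j ≤ d - 2 → 0 < p.coeff j) := by
  obtain ⟨k, rfl⟩ := Nat.exists_eq_add_of_le' (show 3 ≤ d by omega)
  have hk : (1 : ℚ) ≤ k := by exact_mod_cast (by omega : 1 ≤ k)
  have hr : 0 < 2 ^ k := by positivity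
  have hkr : k < 2 ^ k := Nat.lt_two_pow_self
  have hchoose : ∀ j, (k.choose j : ℚ) ≤ (2 ^ k : ℕ) := fun j => by
    exact_mod_cast Nat.choose_le_two_pow k j
  set r : ℕ := 2 ^ k
  have hkr' : (k : ℚ) < r := by exact_mod_cast hkr
  have hr' : (0 : ℚ) < r := by exact_mod_cast hr
  have hr1 : (1 : ℚ) ≤ r := by exact_mod_cast hr
  refine ⟨reevePrism k r (6 * (r + 4) : ℕ), reevePrismPoly k r (r + 4),
    isIntegralPolytope_reevePrism k hr (by omega),
    affineSpan_reevePrism k (by positivity) (by positivity),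
    natDegree_reevePrismPoly k (by positivity) (by positivity),
    by simp [coeff_reevePrismPoly], fun t ht => ?_, ?_, ?_, fun j hj hjd => ?_⟩
  · rw [latticeCount_reevePrism k (by omega) ht, eval_reevePrismPoly, Nat.cast_mul,
      card_reevePoints]
    push_cast
    ring
  · simp [coeff_reevePrismPoly]
    nlinarith
  · have h2 := hchoose 2
    simp [coeff_reevePrismPoly]
    nlinarith [mul_le_mul_of_nonneg_right hk (show (0 : ℚ) ≤ r * (r + 2) by positivity)]
  · have h1 := hchoose (j - 1)
    have h3 : (1 : ℚ) ≤ k.choose (j - 3) := by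
      exact_mod_cast Nat.choose_pos (by omega)
    rw [coeff_reevePrismPoly, if_pos hj, if_pos (by omega), if_pos (by omega)]
    have e1 := mul_le_mul_of_nonneg_left h3 (show (0 : ℚ) ≤ (r + 4) * r ^ 3 by positivity)
    have e2 := mul_le_mul_of_nonneg_left h1 (show (0 : ℚ) ≤ (r + 2) * r by positivity)
    have e3 : (0 : ℚ) ≤ r ^ 2 * k.choose (j - 2) := by positivity
    have e4 : (0 : ℚ) ≤ k.choose j := by positivity
    have e5 : (r : ℚ) ^ 2 * 1 ≤ r ^ 2 * r := mul_le_mul_of_nonneg_left hr1 (by positivity)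
    nlinarith [mul_le_mul_of_nonneg_left e5 hr'.le]
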